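/- Weighted averaging lemma, L²-weight version: let c ∈ ℝ, let 1/2 ≤ α' < α, and let f : [0,∞) → ℝ be continuous with (1/t) ∫_0^t f(s) ds = c + o(t^{α'−1}) as t → ∞. Then ( ∫_0^t ω_s² f(s) ds ) / V_t² = c + o(t^{α'−α}) as t → ∞. -/

import Mathlib

open MeasureTheory ProbabilityTheory Filter Real Asymptotics

noncomputable section

/-- The weight `ω_s = s^(-α/2) exp(s^(1-α) / (2(1-α)))`. -/
def wgt (α s : ℝ) : ℝ := s ^ (-α / 2) * Real.exp (s ^ (1 - α) / (2 * (1 - α)))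

/-- The derivative of the weight: `ω'_s = ω_s (s^(-α)/2 - α/(2s))`. -/
def wgt' (α s : ℝ) : ℝ := wgt α s * (s ^ (-α) / 2 - α / (2 * s))

/-- `U_t = ∫₀ᵗ ω_s ds`. -/
def Uw (α t : ℝ) : ℝ := ∫ s in (0:ℝ)..t, wgt α s

/-- `V_t² = ∫₀ᵗ ω_s² ds`. -/
def Vsq (α t : ℝ) : ℝ := ∫ s in (0:ℝ)..t, (wgt α s) ^ 2

/-- One-sided comparison behind `isLittleO_of_deriv_isLittleO`. -/
theorem eventually_le_mul_of_deriv_le {R H R' H' : ℝ → ℝ} {ε : ℝ} (hε : 0 < ε)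
    (hR : ∀ᶠ t in atTop, HasDerivAt R (R' t) t) (hH : ∀ᶠ t in atTop, HasDerivAt H (H' t) t)
    (hle : ∀ᶠ t in atTop, R' t ≤ ε / 2 * H' t) (hlim : Tendsto H atTop atTop) :
    ∀ᶠ t in atTop, R t ≤ ε * H t := by
  obtain ⟨T, hT⟩ := eventually_atTop.1 (hR.and (hH.and hle))
  have hderiv : ∀ t, T ≤ t →
      HasDerivAt (fun t => ε / 2 * H t - R t) (ε / 2 * H' t - R' t) t := fun t ht =>
    ((hT t ht).2.1.const_mul (ε / 2)).sub (hT t ht).1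
  have hmono : MonotoneOn (fun t => ε / 2 * H t - R t) (Set.Ici T) := by
    refine monotoneOn_of_hasDerivWithinAt_nonneg (f' := fun t => ε / 2 * H' t - R' t)
      (convex_Ici T)
      (fun t ht => (hderiv t ht).continuousAt.continuousWithinAt) (fun t ht => ?_) (fun t ht => ?_)
    · exact (hderiv t (interior_subset ht)).hasDerivWithinAt
    · exact sub_nonneg.2 (hT t (interior_subset ht)).2.2
  filter_upwards [eventually_ge_atTop T,
    (hlim.const_mul_atTop (half_pos hε)).eventually_ge_atTop (-(ε / 2 * H T - R T))] with t ht hHt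
  have h := hmono (Set.mem_Ici.2 le_rfl) (Set.mem_Ici.2 ht) ht
  simp only at h
  linarith

/-- A form of L'Hôpital's rule: if `R' = o(H')`, `H' ≥ 0` eventually and `H → ∞`, then
`R = o(H)`. -/
theorem isLittleO_of_deriv_isLittleO {R H R' H' : ℝ → ℝ}
    (hR : ∀ᶠ t in atTop, HasDerivAt R (R' t) t) (hH : ∀ᶠ t in atTop, HasDerivAt H (H' t) t)
    (hH' : ∀ᶠ t in atTop, 0 ≤ H' t) (ho : R' =o[atTop] H') (hlim : Tendsto H atTop atTop) :
    R =o[atTop] H := by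
  refine isLittleO_iff.2 fun ε hε => ?_
  have hb : ∀ᶠ t in atTop, |R' t| ≤ ε / 2 * H' t := by
    filter_upwards [isLittleO_iff.1 ho (half_pos hε), hH'] with t ht h0
    rwa [norm_eq_abs, norm_eq_abs, abs_of_nonneg h0] at ht
  have h₁ := eventually_le_mul_of_deriv_le hε hR hH
    (hb.mono fun t ht => (le_abs_self _).trans ht) hlim
  have h₂ := eventually_le_mul_of_deriv_le (R := fun t => -R t) (R' := fun t => -R' t) hε
    (hR.mono fun t ht => ht.neg) hH (hb.mono fun t ht => (neg_le_abs _).trans ht) hlim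
  filter_upwards [h₁, h₂, hlim.eventually_ge_atTop 0] with t h₁ h₂ h0
  rw [norm_eq_abs, norm_eq_abs, abs_of_nonneg h0]
  exact abs_le.2 ⟨by linarith, h₁⟩

/-- The primitive `exp (s^(1-α) / (1-α))` of the squared weight. -/
def expPrim (α s : ℝ) : ℝ := Real.exp (s ^ (1 - α) / (1 - α))

theorem expPrim_pos (α s : ℝ) : 0 < expPrim α s := Real.exp_pos _

theorem continuous_expPrim {α : ℝ} (hα1 : α < 1) : Continuous (expPrim α) :=
  Real.continuous_exp.comp
    ((Real.continuous_rpow_const (by linarith)).div_const _)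

theorem hasDerivAt_expPrim {α t : ℝ} (hα1 : α < 1) (ht : 0 < t) :
    HasDerivAt (expPrim α) (t ^ (-α) * expPrim α t) t := by
  have h := (((Real.hasDerivAt_rpow_const (p := 1 - α) (Or.inl ht.ne')).div_const (1 - α)).exp)
  have h1 : (1 - α) ≠ 0 := by linarith
  refine h.congr_deriv ?_
  rw [show 1 - α - 1 = -α by ring, mul_div_cancel_left₀ _ h1, mul_comm]
  rfl

theorem hasDerivAt_rpow_mul_expPrim {α t : ℝ} (hα1 : α < 1) (ht : 0 < t) (p : ℝ) :
    HasDerivAt (fun s => s ^ p * expPrim α s)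
      (t ^ (p - α) * expPrim α t * (1 + p * t ^ (α - 1))) t := by
  refine ((Real.hasDerivAt_rpow_const (p := p) (Or.inl ht.ne')).mul
    (hasDerivAt_expPrim hα1 ht)).congr_deriv ?_
  have h₁ : t ^ (p - 1) = t ^ (p - α) * t ^ (α - 1) := by
    rw [← Real.rpow_add ht]; ring_nf
  have h₂ : t ^ (p - α) = t ^ p * t ^ (-α) := by
    rw [← Real.rpow_add ht]; ring_nf
  rw [h₁, h₂]
  ring

theorem tendsto_rpow_mul_expPrim_atTop {α : ℝ} (hα1 : α < 1) (p : ℝ) :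
    Tendsto (fun t => t ^ p * expPrim α t) atTop atTop := by
  have h1 : 0 < 1 - α := by linarith
  refine ((tendsto_exp_mul_div_rpow_atTop (-p / (1 - α)) (1 - α)⁻¹ (inv_pos.2 h1)).comp
    (tendsto_rpow_atTop h1)).congr' ?_
  filter_upwards [eventually_gt_atTop 0] with t ht
  simp only [Function.comp, expPrim]
  rw [← Real.rpow_mul ht.le, mul_div_cancel₀ _ h1.ne', Real.rpow_neg ht.le, div_inv_eq_mul,
    mul_comm, inv_mul_eq_div]

theorem wgt_sq {α s : ℝ} (hs : 0 ≤ s) : wgt α s ^ 2 = s ^ (-α) * expPrim α s := by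
  rw [wgt, expPrim, mul_pow, ← Real.rpow_natCast, ← Real.rpow_mul hs, ← Real.exp_nat_mul]
  congr 2
  · push_cast; ring
  · push_cast
    rw [mul_comm 2 (1 - α), ← div_div]
    ring

theorem intervalIntegrable_wgt_sq_mul {α t : ℝ} (hα1 : α < 1) (ht : 0 ≤ t) {f : ℝ → ℝ}
    (hf : ContinuousOn f (Set.Ici 0)) :
    IntervalIntegrable (fun s => wgt α s ^ 2 * f s) volume 0 t := by
  have h : IntervalIntegrable (fun s : ℝ => s ^ (-α) * (expPrim α s * f s)) volume 0 t :=
    (intervalIntegral.intervalIntegrable_rpow' (by linarith)).mul_continuousOn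
      ((continuous_expPrim hα1).continuousOn.mul
        (hf.mono (by rw [Set.uIcc_of_le ht]; exact Set.Icc_subset_Ici_self)))
  refine h.congr fun s hs => ?_
  rw [Set.uIoc_of_le ht] at hs
  simp only [wgt_sq hs.1.le, mul_assoc]

theorem Vsq_eq {α t : ℝ} (hα1 : α < 1) (ht : 0 ≤ t) : Vsq α t = expPrim α t - 1 := by
  have h0 : expPrim α 0 = 1 := by
    rw [expPrim, Real.zero_rpow (by linarith), zero_div, Real.exp_zero]
  rw [Vsq, ← h0]
  refine intervalIntegral.integral_eq_sub_of_hasDerivAt_of_le ht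
    (continuous_expPrim hα1).continuousOn (fun s hs => ?_) ?_
  · rw [wgt_sq hs.1.le]
    exact hasDerivAt_expPrim hα1 hs.1
  · simpa using intervalIntegrable_wgt_sq_mul hα1 ht (continuousOn_const (c := (1 : ℝ)))

/-- The fundamental theorem of calculus at `t > 0` for a function continuous on `(0, ∞)` and
integrable at `0`. -/
theorem hasDerivAt_integral_of_continuousOn_Ioi {g : ℝ → ℝ} {t : ℝ} (ht : 0 < t)
    (hg : ContinuousOn g (Set.Ioi 0)) (hi : IntervalIntegrable g volume 0 t) :
    HasDerivAt (fun u => ∫ s in (0:ℝ)..u, g s) (g t) t :=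
  intervalIntegral.integral_hasDerivAt_right hi
    (hg.stronglyMeasurableAtFilter isOpen_Ioi t ht) (hg.continuousAt (Ioi_mem_nhds ht))

theorem continuousOn_wgt_sq {α : ℝ} (hα1 : α < 1) :
    ContinuousOn (fun s => wgt α s ^ 2) (Set.Ioi 0) := by
  refine ContinuousOn.congr (f := fun s => s ^ (-α) * expPrim α s) (fun s hs => ?_)
    fun s hs => wgt_sq (le_of_lt hs)
  exact (hasDerivAt_rpow_mul_expPrim hα1 hs (-α)).continuousAt.continuousWithinAt

/-- Integrating by parts the centred weighted integral against `∫ f - c t` leaves a remainder of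
order `o(t^(α'-α) exp (t^(1-α) / (1-α)))`. -/
theorem isLittleO_integral_sub_boundary {α α' c : ℝ} (hα : 0 ≤ α) (hα1 : α < 1)
    (hα' : 0 ≤ α') {f : ℝ → ℝ} (hf : ContinuousOn f (Set.Ici 0))
    (hmean : (fun t : ℝ => (∫ s in (0:ℝ)..t, f s) - c * t) =o[atTop] fun t => t ^ α') :
    (fun t : ℝ => (∫ s in (0:ℝ)..t, wgt α s ^ 2 * (f s - c)) -
      t ^ (-α) * expPrim α t * ((∫ s in (0:ℝ)..t, f s) - c * t)) =o[atTop]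
      fun t => t ^ (α' - α) * expPrim α t := by
  have hfc : ContinuousOn (fun s => f s - c) (Set.Ici 0) := hf.sub continuousOn_const
  have hr : ∀ᶠ t : ℝ in atTop, t ^ (α - 1) ≤ 1 / 2 := by
    have h := tendsto_rpow_neg_atTop (y := 1 - α) (by linarith)
    rw [neg_sub] at h
    exact h.eventually_le_const (by norm_num)
  have hH'_ge : ∀ᶠ t : ℝ in atTop, t ^ (α' - α - α) * expPrim α t / 2 ≤
      t ^ (α' - α - α) * expPrim α t * (1 + (α' - α) * t ^ (α - 1)) := by
    filter_upwards [hr, eventually_gt_atTop 0] with t hr ht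
    have h0 : 0 ≤ t ^ (α' - α - α) * expPrim α t :=
      mul_nonneg (Real.rpow_nonneg ht.le _) (expPrim_pos _ _).le
    have hr0 : 0 ≤ t ^ (α - 1) := Real.rpow_nonneg ht.le _
    rw [div_eq_mul_one_div]
    refine mul_le_mul_of_nonneg_left ?_ h0
    nlinarith
  refine isLittleO_of_deriv_isLittleO
    (R' := fun t => -(t ^ (-α - α) * expPrim α t * (1 + (-α) * t ^ (α - 1)) *
      ((∫ s in (0:ℝ)..t, f s) - c * t)))
    (H' := fun t => t ^ (α' - α - α) * expPrim α t * (1 + (α' - α) * t ^ (α - 1)))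
    ?_ ?_ ?_ ?_ (tendsto_rpow_mul_expPrim_atTop hα1 _)
  · filter_upwards [eventually_gt_atTop 0] with t ht
    have hN : HasDerivAt (fun t : ℝ => ∫ s in (0:ℝ)..t, wgt α s ^ 2 * (f s - c))
        (wgt α t ^ 2 * (f t - c)) t :=
      hasDerivAt_integral_of_continuousOn_Ioi ht
        ((continuousOn_wgt_sq hα1).mul (hfc.mono Set.Ioi_subset_Ici_self))
        (intervalIntegrable_wgt_sq_mul hα1 ht.le hfc)
    have hF : HasDerivAt (fun t : ℝ => ∫ s in (0:ℝ)..t, f s) (f t) t :=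
      hasDerivAt_integral_of_continuousOn_Ioi ht (hf.mono Set.Ioi_subset_Ici_self)
        (hf.mono (by rw [Set.uIcc_of_le ht.le]; exact Set.Icc_subset_Ici_self)).intervalIntegrable
    refine (hN.sub ((hasDerivAt_rpow_mul_expPrim hα1 ht (-α)).mul
      (hF.sub ((hasDerivAt_id t).const_mul c)))).congr_deriv ?_
    rw [wgt_sq ht.le]
    simp only [Pi.sub_apply, id]
    ring
  · filter_upwards [eventually_gt_atTop 0] with t ht using hasDerivAt_rpow_mul_expPrim hα1 ht _
  · filter_upwards [hH'_ge, eventually_gt_atTop 0] with t h ht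
    exact le_trans (by have := expPrim_pos α t; positivity) h
  · refine isLittleO_iff.2 fun ε hε => ?_
    filter_upwards [isLittleO_iff.1 hmean (half_pos hε), hH'_ge, hr, eventually_gt_atTop 0]
      with t hG hH hr ht
    have hr0 : 0 ≤ t ^ (α - 1) := Real.rpow_nonneg ht.le _
    have hE := expPrim_pos α t
    have hfac : |1 + -α * t ^ (α - 1)| ≤ 1 := abs_le.2 ⟨by nlinarith, by nlinarith⟩
    have hA : 0 ≤ t ^ (-α - α) * expPrim α t := by positivity
    rw [norm_eq_abs, norm_eq_abs, abs_of_nonneg (Real.rpow_nonneg ht.le _)] at hG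
    rw [norm_neg, norm_mul, norm_mul, norm_eq_abs, norm_eq_abs, norm_eq_abs, abs_of_nonneg hA]
    calc t ^ (-α - α) * expPrim α t * |1 + -α * t ^ (α - 1)| *
          |(∫ s in (0:ℝ)..t, f s) - c * t|
        ≤ t ^ (-α - α) * expPrim α t * 1 * (ε / 2 * t ^ α') := by gcongr
      _ = ε * (t ^ (α' - α - α) * expPrim α t / 2) := by
        rw [show α' - α - α = (-α - α) + α' by ring, Real.rpow_add ht]; ring
      _ ≤ ε * ‖t ^ (α' - α - α) * expPrim α t * (1 + (α' - α) * t ^ (α - 1))‖ := by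
        gcongr
        exact hH.trans (le_abs_self _)

/-- Weighted averaging lemma, L²-weight version: if `(1/t) ∫₀ᵗ f = c + o(t^(α'-1))`, then
`(∫₀ᵗ ω_s² f(s) ds) / V_t² = c + o(t^(α'-α))`. -/
theorem weighted_average_sq (α α' c : ℝ) (hα : 1 / 2 < α) (hα1 : α < 1)
    (hα' : 1 / 2 ≤ α') (hα'α : α' < α)
    (f : ℝ → ℝ) (hf : ContinuousOn f (Set.Ici 0))
    (hmean : Tendsto (fun t : ℝ => t ^ (1 - α') * ((1 / t) * (∫ s in (0:ℝ)..t, f s) - c))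
      atTop (nhds 0)) :
    Tendsto
      (fun t : ℝ => t ^ (α - α') * ((∫ s in (0:ℝ)..t, (wgt α s) ^ 2 * f s) / Vsq α t - c))
      atTop (nhds 0) := by
  set G : ℝ → ℝ := fun t => (∫ s in (0:ℝ)..t, f s) - c * t with hG
  set N : ℝ → ℝ := fun t => ∫ s in (0:ℝ)..t, wgt α s ^ 2 * (f s - c) with hN
  have hmean' : Tendsto (fun t => G t / t ^ α') atTop (nhds 0) := by
    refine hmean.congr' ?_
    filter_upwards [eventually_gt_atTop 0] with t ht
    rw [Real.rpow_sub ht, Real.rpow_one, hG]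
    field_simp
  have hGo : G =o[atTop] fun t => t ^ α' :=
    (isLittleO_iff_tendsto' <| (eventually_gt_atTop 0).mono fun t ht h =>
      absurd h (Real.rpow_pos_of_pos ht _).ne').2 hmean'
  have hrem := (isLittleO_integral_sub_boundary (by linarith) hα1 (by linarith) hf
    hGo).tendsto_div_nhds_zero
  have hE : Tendsto (expPrim α) atTop atTop := by
    simpa using tendsto_rpow_mul_expPrim_atTop hα1 0
  have hratio : Tendsto (fun t => (1 - (expPrim α t)⁻¹)⁻¹) atTop (nhds 1) := by
    simpa using (hE.inv_tendsto_atTop.const_sub 1).inv₀ (by norm_num)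
  have hprod := (hrem.add hmean').mul hratio
  rw [add_zero, zero_mul] at hprod
  refine hprod.congr' ?_
  filter_upwards [eventually_gt_atTop 0, hE.eventually_gt_atTop 1] with t ht hE1
  have hNt : N t = (∫ s in (0:ℝ)..t, wgt α s ^ 2 * f s) - c * Vsq α t := by
    rw [hN, Vsq, ← intervalIntegral.integral_const_mul, ← intervalIntegral.integral_sub
      (intervalIntegrable_wgt_sq_mul hα1 ht.le hf)
      (by simpa only [mul_comm] using
        intervalIntegrable_wgt_sq_mul hα1 ht.le (continuousOn_const (c := c)))]
    simp only [mul_sub, mul_comm c]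
  have hV : expPrim α t - 1 ≠ 0 := by linarith
  have hE0 := (expPrim_pos α t).ne'
  have hpos := Real.rpow_pos_of_pos ht
  change ((N t - t ^ (-α) * expPrim α t * G t) / (t ^ (α' - α) * expPrim α t) + G t / t ^ α') *
    (1 - (expPrim α t)⁻¹)⁻¹ = _
  rw [eq_add_of_sub_eq hNt.symm, Vsq_eq hα1 ht.le, ← neg_sub α' α, Real.rpow_neg ht.le (α' - α),
    sub_eq_add_neg α' α, Real.rpow_add ht]
  have hP := (hpos α').ne'
  have hQ := (hpos (-α)).ne'
  have hinv : (1 - (expPrim α t)⁻¹)⁻¹ = expPrim α t / (expPrim α t - 1) := by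
    field_simp
  rw [hinv]
  generalize t ^ α' = P at *
  generalize t ^ (-α) = Q at *
  field_simp
  ring
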